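/- (Proposition 1, pure-state case) Let N ≥ 2 and let Φ = α|0⟩^{⊗N} + β|1⟩^{⊗N} be a unit vector in (ℂ²)^{⊗N} with |α|² + |β|² = 1. Then the GME-concurrence of Φ, namely min over bipartitions γ|γ̄ of √(2(1 − Tr[(Tr_{γ̄}|Φ⟩⟨Φ|)²])), equals 2|α||β|, which equals the l₁-norm coherence C_{l₁}(α|0⟩ + β|1⟩) of the corresponding single-qubit pure state. -/

import Mathlib

open scoped BigOperators
open Matrix
open scoped ComplexOrder

/-- Combine an assignment of indices on `γ` and one on `γᶜ` into a global index. -/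
def mergeIdx {N : ℕ} {dims : Fin N → ℕ} (γ : Finset (Fin N))
    (a : ∀ i : {i // i ∈ γ}, Fin (dims i.1))
    (b : ∀ i : {i // i ∈ γᶜ}, Fin (dims i.1)) : ∀ i, Fin (dims i) := fun i =>
  if h : i ∈ γ then a ⟨i, h⟩ else b ⟨i, Finset.mem_compl.mpr h⟩

/-- The reduced density matrix of the pure state `ψ` on the parties in `γ`
(the parties in `γᶜ` are traced out). -/
noncomputable def reducedMat {N : ℕ} {dims : Fin N → ℕ} (γ : Finset (Fin N))
    (ψ : (∀ i, Fin (dims i)) → ℂ) :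
    Matrix (∀ i : {i // i ∈ γ}, Fin (dims i.1)) (∀ i : {i // i ∈ γ}, Fin (dims i.1)) ℂ :=
  Matrix.of fun a a' => ∑ b : ∀ i : {i // i ∈ γᶜ}, Fin (dims i.1),
    ψ (mergeIdx γ a b) * star (ψ (mergeIdx γ a' b))

/-- All nonempty proper subsets of the parties.  Each bipartition `γ|γ̄` occurs
here as both `γ` and `γ̄`, with equal associated values. -/
def bips (N : ℕ) : Finset (Finset (Fin N)) :=
  Finset.univ.filter fun γ => γ.Nonempty ∧ γ ≠ Finset.univ

/-- The bipartite concurrence `√(2(1 - Tr ρ_γ²))` of a pure state across the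
bipartition `γ|γ̄`. -/
noncomputable def bipConc {N : ℕ} {dims : Fin N → ℕ} (γ : Finset (Fin N))
    (ψ : (∀ i, Fin (dims i)) → ℂ) : ℝ :=
  Real.sqrt (2 * (1 - ((reducedMat γ ψ * reducedMat γ ψ).trace).re))

/-- The GME-concurrence of a pure state: the minimum of the bipartite
concurrence over all bipartitions. -/
noncomputable def gmeConcPure {N : ℕ} {dims : Fin N → ℕ}
    (ψ : (∀ i, Fin (dims i)) → ℂ) : ℝ :=
  sInf {x | ∃ γ ∈ bips N, x = bipConc γ ψ}

/-- Convex roof extension of a pure-state functional `E` to mixed states. -/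
noncomputable def convexRoof {ι : Type*} [Fintype ι] (E : (ι → ℂ) → ℝ)
    (ρ : Matrix ι ι ℂ) : ℝ :=
  sInf {x | ∃ (K : ℕ) (p : Fin K → ℝ) (ψ : Fin K → ι → ℂ),
    (∀ k, 0 < p k) ∧ (∀ k, ∑ t, ‖ψ k t‖ ^ 2 = 1) ∧
    ρ = ∑ k, (Matrix.of fun t s => ((p k : ℂ)) * (ψ k t * star (ψ k s)) : Matrix ι ι ℂ) ∧
    x = ∑ k, p k * E (ψ k)}

/-- The `l₁`-norm of coherence: the sum of the absolute values of the
off-diagonal entries. -/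
noncomputable def Cl1 {d : ℕ} (ρ : Matrix (Fin d) (Fin d) ℂ) : ℝ :=
  ∑ i, ∑ j, if i = j then 0 else ‖ρ i j‖

/-- The generalized GHZ state `α|0⟩^{⊗N} + β|1⟩^{⊗N}`. -/
noncomputable def ghzState (N : ℕ) (α β : ℂ) : (∀ _ : Fin N, Fin 2) → ℂ := fun t =>
  if ∀ i, t i = 0 then α else if ∀ i, t i = 1 then β else 0

lemma ghzState_mergeIdx {N : ℕ} (α β : ℂ) {γ : Finset (Fin N)} (hγ : γ.Nonempty)
    (a : {i // i ∈ γ} → Fin 2) (b : {i // i ∈ γᶜ} → Fin 2) :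
    ghzState N α β (mergeIdx (dims := fun _ => 2) γ a b) =
      if a = (fun _ => 0) then (if b = (fun _ => 0) then α else 0)
      else if a = (fun _ => 1) then (if b = (fun _ => 1) then β else 0) else 0 := by
  have key (c : Fin 2) : (∀ i, mergeIdx (dims := fun _ => 2) γ a b i = c) ↔
      a = (fun _ => c) ∧ b = (fun _ => c) := by
    constructor
    · refine fun h => ⟨funext fun i => ?_, funext fun i => ?_⟩
      · simpa [mergeIdx, i.2] using h i.1
      · simpa [mergeIdx, Finset.mem_compl.mp i.2] using h i.1
    · rintro ⟨rfl, rfl⟩ i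
      simp [mergeIdx]
  have hne : (fun _ : {i // i ∈ γ} => (0 : Fin 2)) ≠ fun _ => 1 := by
    obtain ⟨i, hi⟩ := hγ
    exact fun h => zero_ne_one (congrFun h ⟨i, hi⟩)
  unfold ghzState
  simp only [key]
  by_cases h0 : a = fun _ => 0
  · subst h0
    simp [hne]
  · simp only [h0, false_and, if_false, ite_and]

lemma reducedMat_ghzState {N : ℕ} (α β : ℂ) {γ : Finset (Fin N)} (hγ : γ.Nonempty)
    (hγ' : γ ≠ Finset.univ) :
    reducedMat (dims := fun _ => 2) γ (ghzState N α β) =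
      Matrix.diagonal fun a : {i // i ∈ γ} → Fin 2 =>
        if a = (fun _ => 0) then α * star α
        else if a = (fun _ => 1) then β * star β else 0 := by
  have hne : (fun _ : {i // i ∈ γᶜ} => (0 : Fin 2)) ≠ fun _ => 1 := by
    obtain ⟨i, hi⟩ : γᶜ.Nonempty := by
      rwa [Finset.nonempty_iff_ne_empty, Ne, Finset.compl_eq_empty_iff]
    exact fun h => zero_ne_one (congrFun h ⟨i, hi⟩)
  ext a a'
  change ∑ b : {i // i ∈ γᶜ} → Fin 2,
    ghzState N α β (mergeIdx (dims := fun _ => 2) γ a b) *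
      star (ghzState N α β (mergeIdx (dims := fun _ => 2) γ a' b)) = _
  simp only [ghzState_mergeIdx α β hγ, Matrix.diagonal_apply]
  by_cases h : a = a'
  · subst h
    rw [if_pos rfl]
    split_ifs <;> simp
  · rw [if_neg h]
    refine Finset.sum_eq_zero fun b _ => ?_
    split_ifs <;> simp_all

lemma bipConc_ghzState {N : ℕ} {α β : ℂ} (hnorm : ‖α‖ ^ 2 + ‖β‖ ^ 2 = 1)
    {γ : Finset (Fin N)} (hγ : γ ∈ bips N) :
    bipConc (dims := fun _ => 2) γ (ghzState N α β) = 2 * ‖α‖ * ‖β‖ := by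
  obtain ⟨hγ, hγ'⟩ := (Finset.mem_filter.mp hγ).2
  have hne : (fun _ : {i // i ∈ γ} => (1 : Fin 2)) ≠ fun _ => 0 := by
    obtain ⟨i, hi⟩ := hγ
    exact fun h => one_ne_zero (congrFun h ⟨i, hi⟩)
  have htr : (reducedMat (dims := fun _ => 2) γ (ghzState N α β) *
      reducedMat (dims := fun _ => 2) γ (ghzState N α β)).trace =
      ((‖α‖ ^ 4 + ‖β‖ ^ 4 : ℝ) : ℂ) := by
    rw [reducedMat_ghzState α β hγ hγ', Matrix.diagonal_mul_diagonal, Matrix.trace_diagonal]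
    have hterm (a : {i // i ∈ γ} → Fin 2) :
        ((if a = (fun _ => 0) then α * star α
          else if a = (fun _ => 1) then β * star β else 0) *
        (if a = (fun _ => 0) then α * star α
          else if a = (fun _ => 1) then β * star β else 0) : ℂ) =
        (if a = (fun _ => 0) then (‖α‖ : ℂ) ^ 4 else 0) +
          (if a = (fun _ => 1) then (‖β‖ : ℂ) ^ 4 else 0) := by
      have hsq (z : ℂ) : z * star z * (z * star z) = (‖z‖ : ℂ) ^ 4 := by
        rw [← starRingEnd_apply, Complex.mul_conj']
        ring
      by_cases h0 : a = fun _ => 0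
      · subst h0
        simp only [if_true, if_neg hne.symm, hsq, add_zero]
      · by_cases h1 : a = fun _ => 1
        · subst h1
          simp only [if_neg hne, if_true, hsq, zero_add]
        · simp [h0, h1]
    refine (Finset.sum_congr rfl fun a _ => hterm a).trans ?_
    rw [Finset.sum_add_distrib]
    simp
  rw [bipConc, htr, Complex.ofReal_re]
  have : 2 * (1 - (‖α‖ ^ 4 + ‖β‖ ^ 4)) = (2 * ‖α‖ * ‖β‖) ^ 2 := by
    linear_combination -2 * (‖α‖ ^ 2 + ‖β‖ ^ 2 + 1) * hnorm
  rw [this, Real.sqrt_sq (by positivity)]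

lemma bips_nonempty {N : ℕ} (hN : 2 ≤ N) : (bips N).Nonempty := by
  refine ⟨{⟨0, by lia⟩}, Finset.mem_filter.mpr
    ⟨Finset.mem_univ _, Finset.singleton_nonempty _, fun h => ?_⟩⟩
  have := congrArg Finset.card h
  simp at this
  lia

lemma gmeConcPure_ghzState {N : ℕ} (hN : 2 ≤ N) {α β : ℂ} (hnorm : ‖α‖ ^ 2 + ‖β‖ ^ 2 = 1) :
    gmeConcPure (dims := fun _ : Fin N => 2) (ghzState N α β) = 2 * ‖α‖ * ‖β‖ := by
  obtain ⟨γ, hγ⟩ := bips_nonempty hN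
  have : {x | ∃ γ ∈ bips N, x = bipConc (dims := fun _ => 2) γ (ghzState N α β)} =
      {2 * ‖α‖ * ‖β‖} := by
    refine Set.eq_singleton_iff_unique_mem.mpr ⟨⟨γ, hγ, (bipConc_ghzState hnorm hγ).symm⟩, ?_⟩
    rintro x ⟨δ, hδ, rfl⟩
    exact bipConc_ghzState hnorm hδ
  rw [gmeConcPure, this, csInf_singleton]

/-- Proposition 1 (pure-state case): for the `N`-qubit state
`Φ = α|0⟩^{⊗N} + β|1⟩^{⊗N}`, the GME-concurrence equals `2|α||β|`, which is the
`l₁`-norm coherence of the single-qubit pure state `α|0⟩ + β|1⟩`. -/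
theorem stmt_11 (N : ℕ) (hN : 2 ≤ N) (α β : ℂ) (hnorm : ‖α‖ ^ 2 + ‖β‖ ^ 2 = 1) :
    let Φ : (∀ _ : Fin N, Fin 2) → ℂ := fun t =>
      if ∀ i, t i = 0 then α else if ∀ i, t i = 1 then β else 0
    gmeConcPure (dims := fun _ : Fin N => 2) Φ = 2 * ‖α‖ * ‖β‖ ∧
    Cl1 (Matrix.of fun i j : Fin 2 => ![α, β] i * star (![α, β] j)) =
      2 * ‖α‖ * ‖β‖ := by
  refine ⟨gmeConcPure_ghzState hN hnorm, ?_⟩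
  simp [Cl1, Fin.sum_univ_two]
  ring
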